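/- Suppose π and π′ are grounded patterns of length k that are strongly c-forest-Wilf equivalent, both with streak s. Then π(s+1) = π′(s+1) or π(s+1) + π′(s+1) = s + k + 1. Moreover, if d is the least positive integer such that the set {π(d), π(d+1), …, π(k)} contains no two consecutive integers, and d′ is the least positive integer such that {π′(d′), …, π′(k)} contains no two consecutive integers, then d = d′. -/

import Mathlib

/-- A rooted labeled forest on `[n]`: vertices are identified with their labels in `Fin n`
(`i : Fin n` representing the label `i+1`), each vertex has an optional parent, and the
parent relation is acyclic. Components are rooted at the vertices with no parent, and
children are unordered since only the parent function is recorded. -/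
structure RForest (n : ℕ) where
  parent : Fin n → Option (Fin n)
  acyclic : ∀ v : Fin n, ¬ Relation.TransGen (fun a b => parent b = some a) v v

namespace RForest

variable {n : ℕ}

/-- `u` is a strict ancestor of `v`. -/
def SAnc (F : RForest n) (u v : Fin n) : Prop :=
  Relation.TransGen (fun a b => F.parent b = some a) u v

/-- `u` is an ancestor of `v` (possibly `u = v`). -/
def Anc (F : RForest n) (u v : Fin n) : Prop :=
  F.SAnc u v ∨ u = v

/-- `F` is a tree: it has exactly one root, i.e. exactly one component. -/
def IsTree (F : RForest n) : Prop :=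
  ∃! r : Fin n, F.parent r = none

end RForest

/-- A pattern of length `k` is a permutation of `[k]` (presented 0-indexed on `Fin k`). -/
abbrev Pattern (k : ℕ) := Equiv.Perm (Fin k)

/-- The complement of a pattern: `π̄(i) = k + 1 - π(i)` in 1-indexed terms. -/
def Pattern.compl {k : ℕ} (π : Pattern k) : Pattern k :=
  π.trans ⟨Fin.rev, Fin.rev, Fin.rev_rev, Fin.rev_rev⟩

/-- `F` contains a (classical) instance of the pattern `π`: vertices `v 0, …, v (k-1)`,
each a strict ancestor of the next, whose labels are in the same relative order as `π`. -/
def ContainsPat {n k : ℕ} (F : RForest n) (π : Pattern k) : Prop :=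
  ∃ v : Fin k → Fin n,
    (∀ i j : Fin k, i < j → F.SAnc (v i) (v j)) ∧
    (∀ i j : Fin k, v i < v j ↔ π i < π j)

/-- `v` is a consecutive instance of `π` in `F`: a downward path (each vertex the parent of
the next) whose labels are in the same relative order as `π`. -/
def IsConsInstance {n k : ℕ} (F : RForest n) (π : Pattern k) (v : Fin k → Fin n) : Prop :=
  (∀ i j : Fin k, (j : ℕ) = (i : ℕ) + 1 → F.parent (v j) = some (v i)) ∧
  (∀ i j : Fin k, v i < v j ↔ π i < π j)

/-- `F` contains a consecutive instance of `π`. -/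
def CContainsPat {n k : ℕ} (F : RForest n) (π : Pattern k) : Prop :=
  ∃ v, IsConsInstance F π v

/-- `F` avoids every pattern in the set `S` (of patterns of arbitrary lengths). -/
def AvoidsSet {n : ℕ} (F : RForest n) (S : Set ((k : ℕ) × Pattern k)) : Prop :=
  ∀ p ∈ S, ¬ ContainsPat F p.2

/-- `f_n(S)`: the number of rooted labeled forests on `[n]` avoiding `S`. -/
noncomputable def fCount (S : Set ((k : ℕ) × Pattern k)) (n : ℕ) : ℕ :=
  Nat.card {F : RForest n // AvoidsSet F S}

/-- `t_n(S)`: the number of rooted labeled trees on `[n]` avoiding `S`. -/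
noncomputable def tCount (S : Set ((k : ℕ) × Pattern k)) (n : ℕ) : ℕ :=
  Nat.card {F : RForest n // F.IsTree ∧ AvoidsSet F S}

/-- The number of rooted labeled forests on `[n]` consecutively avoiding `π`. -/
noncomputable def cCount {k : ℕ} (π : Pattern k) (n : ℕ) : ℕ :=
  Nat.card {F : RForest n // ¬ CContainsPat F π}

/-- c-forest-Wilf equivalence of two patterns. -/
def CForestWilfEquiv {k k' : ℕ} (π : Pattern k) (π' : Pattern k') : Prop :=
  ∀ n : ℕ, cCount π n = cCount π' n

def p123 : Pattern 3 := 1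
def p132 : Pattern 3 := ⟨![0, 2, 1], ![0, 2, 1], by intro x; fin_cases x <;> rfl, by intro x; fin_cases x <;> rfl⟩
def p213 : Pattern 3 := ⟨![1, 0, 2], ![1, 0, 2], by intro x; fin_cases x <;> rfl, by intro x; fin_cases x <;> rfl⟩
def p231 : Pattern 3 := ⟨![1, 2, 0], ![2, 0, 1], by intro x; fin_cases x <;> rfl, by intro x; fin_cases x <;> rfl⟩
def p312 : Pattern 3 := ⟨![2, 0, 1], ![1, 2, 0], by intro x; fin_cases x <;> rfl, by intro x; fin_cases x <;> rfl⟩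
def p321 : Pattern 3 := ⟨![2, 1, 0], ![2, 1, 0], by intro x; fin_cases x <;> rfl, by intro x; fin_cases x <;> rfl⟩
def p2413 : Pattern 4 := ⟨![1, 3, 0, 2], ![2, 0, 3, 1], by intro x; fin_cases x <;> rfl, by intro x; fin_cases x <;> rfl⟩
def p2314 : Pattern 4 := ⟨![1, 2, 0, 3], ![2, 0, 1, 3], by intro x; fin_cases x <;> rfl, by intro x; fin_cases x <;> rfl⟩
def p3142 : Pattern 4 := ⟨![2, 0, 3, 1], ![1, 3, 0, 2], by intro x; fin_cases x <;> rfl, by intro x; fin_cases x <;> rfl⟩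
def p3124 : Pattern 4 := ⟨![2, 0, 1, 3], ![1, 2, 0, 3], by intro x; fin_cases x <;> rfl, by intro x; fin_cases x <;> rfl⟩

/-- The streak of `π`: the largest `m ≤ k` such that `π(i) = i` for all `1 ≤ i ≤ m`
(0-indexed: `π i = i` for all `i < m`). -/
noncomputable def streak {k : ℕ} (π : Pattern k) : ℕ :=
  sSup {m | m ≤ k ∧ ∀ i : Fin k, (i : ℕ) < m → (π i : ℕ) = (i : ℕ)}

/-- The height of the entry at (0-indexed) position `t` of `π`: the largest `m ≤ t` such
that the `m` consecutive entries of `π` ending at position `t` are increasing. -/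
noncomputable def heightAt {k : ℕ} (π : Pattern k) (t : Fin k) : ℕ :=
  sSup {m | m ≤ (t : ℕ) ∧ ∀ a b : Fin k, (t : ℕ) < (a : ℕ) + m →
    (b : ℕ) = (a : ℕ) + 1 → (b : ℕ) ≤ (t : ℕ) → π a < π b}

/-- The max height of `π`: the maximum of the heights over all non-initial positions. -/
noncomputable def maxHeight {k : ℕ} (π : Pattern k) : ℕ :=
  sSup {h | ∃ t : Fin k, 0 < (t : ℕ) ∧ h = heightAt π t}

/-- A pattern is grounded if it is not the identity and its max height is at most its
streak. -/
def Grounded {k : ℕ} (π : Pattern k) : Prop :=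
  π ≠ 1 ∧ maxHeight π ≤ streak π

/-- The number of rooted labeled forests on `[n]` with exactly `m` consecutive
instances of `π`. -/
noncomputable def strongCount {k : ℕ} (π : Pattern k) (n m : ℕ) : ℕ :=
  Nat.card {F : RForest n // Nat.card {v : Fin k → Fin n // IsConsInstance F π v} = m}

/-- Strong c-forest-Wilf equivalence: for all `m, n`, the number of forests on `[n]`
with exactly `m` consecutive instances of `π` equals that for `π'`. -/
def StrongCEquiv {k : ℕ} (π π' : Pattern k) : Prop :=
  ∀ m n : ℕ, strongCount π n m = strongCount π' n m

/-- The least positive integer `d` such that `{π(d), …, π(k)}` contains no two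
consecutive integers (a position `i : Fin k` is counted as the 1-indexed position
`i + 1`). -/
noncomputable def dStat {k : ℕ} (π : Pattern k) : ℕ :=
  sInf {d | 0 < d ∧ ∀ i j : Fin k, d ≤ (i : ℕ) + 1 → d ≤ (j : ℕ) + 1 →
    (π j : ℕ) ≠ (π i : ℕ) + 1}

section ForkCounting

open Finset

namespace RForest

/-- Number of lattice paths from `(0, 0)` to `(a, b)` in which an axis step leaving coordinate
`c` requires `c ∉ S`, and a diagonal step is allowed exactly from `(c, c)` with `c ∈ S`. -/
def pathCount (S : Finset ℕ) : ℕ → ℕ → ℕ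
  | 0, 0 => 1
  | a + 1, 0 => if a ∈ S then 0 else pathCount S a 0
  | 0, b + 1 => if b ∈ S then 0 else pathCount S 0 b
  | a + 1, b + 1 => (if a ∈ S then 0 else pathCount S a (b + 1)) +
      (if b ∈ S then 0 else pathCount S (a + 1) b) +
      (if a = b ∧ a ∈ S then pathCount S a b else 0)
termination_by a b => a + b

section PathCount

variable {S : Finset ℕ}

theorem pathCount_le_left {a : ℕ} (b : ℕ) (ha : a ∉ S) :
    pathCount S a b ≤ pathCount S (a + 1) b := by
  cases b with
  | zero => rw [pathCount.eq_2, if_neg ha]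
  | succ b => rw [pathCount.eq_4, if_neg ha]; omega

theorem pathCount_le_right (a : ℕ) {b : ℕ} (hb : b ∉ S) :
    pathCount S a b ≤ pathCount S a (b + 1) := by
  cases a with
  | zero => rw [pathCount.eq_3, if_neg hb]
  | succ a => rw [pathCount.eq_4, if_neg hb]; omega

theorem pathCount_diag_of_mem {p : ℕ} (hp : p ∈ S) :
    pathCount S (p + 1) (p + 1) = pathCount S p p := by
  rw [pathCount.eq_4]; simp [hp]

theorem pathCount_succ_succ_of_notMem {a b : ℕ} (ha : a ∉ S) (hb : b ∉ S) :
    pathCount S (a + 1) (b + 1) = pathCount S a (b + 1) + pathCount S (a + 1) b := by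
  rw [pathCount.eq_4]; simp [ha, hb]

theorem pathCount_add_add {q g : ℕ} (hq : ∀ r, q = r + 1 → r ∈ S)
    (hg : ∀ p, q ≤ p → p < q + g → p ∉ S) (i j : ℕ) (hi : i ≤ g) (hj : j ≤ g) :
    pathCount S (q + i) (q + j) = (i + j).choose i * pathCount S q q := by
  induction i generalizing j with
  | zero =>
    induction j with
    | zero => simp
    | succ j ih =>
      have h1 := ih (by omega)
      have hj' : q + j ∉ S := hg _ (by omega) (by omega)
      cases q with
      | zero =>
        simp only [Nat.zero_add, Nat.add_zero] at *
        rw [pathCount.eq_3, if_neg hj', h1]; simp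
      | succ r =>
        have hr : r ∈ S := hq r rfl
        have h2 : pathCount S (r + 1) (r + 1 + j + 1) = pathCount S (r + 1) (r + 1 + j) := by
          rw [pathCount.eq_4, if_pos hr, if_neg hj', if_neg (by omega)]; omega
        simp only [Nat.add_zero] at *
        rw [← Nat.add_assoc, h2, h1]; simp
  | succ i ih =>
    have hi' : q + i ∉ S := hg _ (by omega) (by omega)
    induction j with
    | zero =>
      have h1 := ih 0 (by omega) (by omega)
      cases q with
      | zero =>
        simp only [Nat.zero_add, Nat.add_zero] at *
        rw [pathCount.eq_2, if_neg hi', h1]; simp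
      | succ r =>
        have hr : r ∈ S := hq r rfl
        have h2 : pathCount S (r + 1 + i + 1) (r + 1) = pathCount S (r + 1 + i) (r + 1) := by
          rw [pathCount.eq_4, if_pos hr, if_neg hi', if_neg (by omega)]; omega
        simp only [Nat.add_zero] at *
        rw [← Nat.add_assoc, h2, h1]; simp
    | succ j ihj =>
      have h1 := ih (j + 1) (by omega) hj
      have h2 := ihj (by omega)
      have hj' : q + j ∉ S := hg _ (by omega) (by omega)
      rw [← Nat.add_assoc, ← Nat.add_assoc, pathCount_succ_succ_of_notMem hi' hj']
      rw [← Nat.add_assoc] at h1 h2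
      rw [h1, h2, show i + 1 + (j + 1) = (i + j + 1) + 1 by ring, Nat.choose_succ_succ',
        show i + (j + 1) = i + j + 1 by ring, show i + 1 + j = i + j + 1 by ring]
      ring

theorem pathCount_diag_add {q g : ℕ} (hq : ∀ r, q = r + 1 → r ∈ S)
    (hg : ∀ p, q ≤ p → p < q + g → p ∉ S) :
    pathCount S (q + g) (q + g) = g.centralBinom * pathCount S q q := by
  rw [pathCount_add_add hq hg g g le_rfl le_rfl, Nat.centralBinom, two_mul]

theorem six_mul_pathCount_le {p : ℕ} (h0 : p ∉ S) (h1 : p + 1 ∉ S) :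
    6 * pathCount S p p ≤ pathCount S (p + 2) (p + 2) := by
  have e1 := pathCount_succ_succ_of_notMem h1 h1
  have e2 := pathCount_succ_succ_of_notMem h0 h1
  have e3 := pathCount_succ_succ_of_notMem h1 h0
  have e4 := pathCount_succ_succ_of_notMem h0 h0
  have i1 := pathCount_le_right p h0
  have i2 := pathCount_le_right p h1
  have i3 := pathCount_le_left p h0
  have i4 := pathCount_le_left p h1
  simp only [Nat.add_assoc, Nat.reduceAdd] at *
  omega

theorem two_pow_le_pathCount_diag (S : Finset ℕ) (k : ℕ) :
    2 ^ #(range k \ S) ≤ pathCount S k k ∧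
      (pathCount S k k = 2 ^ #(range k \ S) ↔ ∀ p, p + 1 < k → p ∈ S ∨ p + 1 ∈ S) := by
  induction k using Nat.strong_induction_on with
  | _ k ih =>
  rcases k with _ | k
  · simp [pathCount.eq_1]
  by_cases hk : k ∈ S
  · have hs : range (k + 1) \ S = range k \ S := by
      rw [range_add_one, insert_sdiff_of_mem _ hk]
    rw [pathCount_diag_of_mem hk, hs]
    refine ⟨(ih k (by omega)).1, (ih k (by omega)).2.trans ⟨fun h p hp => ?_, fun h p hp => ?_⟩⟩
    · rcases Nat.lt_succ_iff_lt_or_eq.1 hp with h' | h'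
      · exact h p h'
      · exact Or.inr (h' ▸ hk)
    · exact h p (by omega)
  · have hs : #(range (k + 1) \ S) = #(range k \ S) + 1 := by
      rw [range_add_one, insert_sdiff_of_notMem _ hk, card_insert_of_notMem (by simp)]
    rw [hs, pow_succ]
    have base : (∀ r, k = r + 1 → r ∈ S) →
        pathCount S (k + 1) (k + 1) = 2 * pathCount S k k := by
      intro hq
      have := pathCount_diag_add (S := S) (q := k) (g := 1) hq (by
        intro p h1 h2; obtain rfl : p = k := by omega
        exact hk)
      simpa [Nat.centralBinom] using this
    by_cases hq : ∀ r, k = r + 1 → r ∈ S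
    · have h1 := ih k (by omega)
      rw [base hq]
      refine ⟨by omega, ?_⟩
      rw [show 2 * pathCount S k k = 2 ^ #(range k \ S) * 2 ↔
        pathCount S k k = 2 ^ #(range k \ S) by omega, h1.2]
      refine ⟨fun h p hp => ?_, fun h p hp => h p (by omega)⟩
      rcases Nat.lt_succ_iff_lt_or_eq.1 hp with h' | h'
      · exact h p h'
      · exact Or.inl (hq p h'.symm)
    · push Not at hq
      obtain ⟨r, rfl, hr⟩ := hq
      have h1 := (ih r (by omega)).1
      have h6 := six_mul_pathCount_le hr hk
      rw [show r + 2 = r + 1 + 1 from rfl] at h6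
      have hs' : #(range (r + 1) \ S) = #(range r \ S) + 1 := by
        rw [range_add_one, insert_sdiff_of_notMem _ hr, card_insert_of_notMem (by simp)]
      have hpos : 0 < 2 ^ #(range r \ S) := by positivity
      rw [hs', pow_succ]
      refine ⟨by omega, ⟨fun _ => by omega, fun h => ?_⟩⟩
      exact absurd (h r (by omega)) (by simp [hr, hk])

theorem pathCount_diag_of_subset {q : ℕ} (h : ∀ p < q, p ∈ S) : pathCount S q q = 1 := by
  induction q with
  | zero => exact pathCount.eq_1 S
  | succ q ih =>
    rw [pathCount_diag_of_mem (h q (by omega)), ih fun p hp => h p (by omega)]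

theorem pathCount_two_gaps {s a k : ℕ} (hsa : s < a) (hak : a < k)
    (hS : ∀ p < k, p ∈ S ↔ p < s ∨ p = a) :
    pathCount S k k = (k - 1 - a).centralBinom * (a - s).centralBinom := by
  have h1 : pathCount S s s = 1 :=
    pathCount_diag_of_subset fun p hp => (hS p (by omega)).2 (Or.inl hp)
  have h2 := pathCount_diag_add (S := S) (q := s) (g := a - s)
    (fun r hr => (hS r (by omega)).2 (by omega))
    (fun p _ _ => by rw [hS p (by omega)]; omega)
  have h3 := pathCount_diag_of_mem (S := S) (p := a) ((hS a hak).2 (Or.inr rfl))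
  have h4 := pathCount_diag_add (S := S) (q := a + 1) (g := k - 1 - a)
    (fun r hr => (hS r (by omega)).2 (by omega))
    (fun p _ _ => by rw [hS p (by omega)]; omega)
  rw [show s + (a - s) = a by omega, h1] at h2
  rw [show a + 1 + (k - 1 - a) = k by omega, h3, h2] at h4
  simpa using h4

end PathCount

theorem centralBinom_mul_lt {N x : ℕ} (h : 2 * (x + 1) ≤ N) :
    (x + 1).centralBinom * (N - (x + 1)).centralBinom <
      x.centralBinom * (N - x).centralBinom := by
  obtain ⟨y, rfl⟩ : ∃ y, N = x + 1 + y := ⟨N - (x + 1), by omega⟩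
  rw [show x + 1 + y - (x + 1) = y by omega, show x + 1 + y - x = y + 1 by omega]
  have h1 := Nat.succ_mul_centralBinom_succ x
  have h2 := Nat.succ_mul_centralBinom_succ y
  have hx := Nat.centralBinom_pos x
  have hy := Nat.centralBinom_pos y
  have hlt : (2 * x + 1) * (y + 1) < (2 * y + 1) * (x + 1) := by nlinarith
  refine lt_of_mul_lt_mul_left (a := (x + 1) * (y + 1)) ?_ (by positivity)
  calc (x + 1) * (y + 1) * ((x + 1).centralBinom * y.centralBinom)
      = (y + 1) * y.centralBinom * ((x + 1) * (x + 1).centralBinom) := by ring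
    _ = 2 * (x.centralBinom * y.centralBinom) * ((2 * x + 1) * (y + 1)) := by rw [h1]; ring
    _ < 2 * (x.centralBinom * y.centralBinom) * ((2 * y + 1) * (x + 1)) := by gcongr
    _ = (x + 1) * x.centralBinom * ((y + 1) * (y + 1).centralBinom) := by rw [h2]; ring
    _ = _ := by ring

theorem centralBinom_mul_strictAnti {N x y : ℕ} (hxy : x < y) (h : 2 * y ≤ N) :
    y.centralBinom * (N - y).centralBinom < x.centralBinom * (N - x).centralBinom := by
  induction y, hxy using Nat.le_induction with
  | base => exact centralBinom_mul_lt h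
  | succ y _ ih => exact (centralBinom_mul_lt h).trans (ih (by omega))

theorem eq_or_eq_of_centralBinom_mul_eq {N x y : ℕ} (hx : x ≤ N) (hy : y ≤ N)
    (h : x.centralBinom * (N - x).centralBinom = y.centralBinom * (N - y).centralBinom) :
    x = y ∨ x + y = N := by
  have key : ∀ x y : ℕ, 2 * x ≤ N → 2 * y ≤ N →
      x.centralBinom * (N - x).centralBinom = y.centralBinom * (N - y).centralBinom → x = y := by
    intro x y hx hy h
    rcases lt_trichotomy x y with h' | h' | h'
    · exact absurd h (centralBinom_mul_strictAnti h' hy).ne'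
    · exact h'
    · exact absurd h (centralBinom_mul_strictAnti h' hx).ne
  have flip : ∀ z ≤ N, z.centralBinom * (N - z).centralBinom =
      (N - z).centralBinom * (N - (N - z)).centralBinom := by
    intro z hz; rw [Nat.sub_sub_self hz, mul_comm]
  rcases le_total (2 * x) N with h1 | h1 <;> rcases le_total (2 * y) N with h2 | h2
  · exact Or.inl (key x y h1 h2 h)
  · have := key x (N - y) h1 (by omega) (h.trans (flip y hy)); omega
  · have := key (N - x) y (by omega) h2 ((flip x hx).symm.trans h); omega
  · have := key (N - x) (N - y) (by omega) (by omega)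
      ((flip x hx).symm.trans (h.trans (flip y hy))); omega

/-- The number of elements of `X` smaller than `u`. -/
def below (X : Finset ℕ) (u : ℕ) : ℕ := #{x ∈ X | x < u}

/-- `X` and `Y`, listed increasingly, agree at the positions in `S` and have no other common
elements. -/
def Interlaced (S X Y : Finset ℕ) : Prop :=
  (∀ u ∈ X, below X u ∈ S → u ∈ Y) ∧ (∀ u ∈ Y, below Y u ∈ S → u ∈ X) ∧
    ∀ u ∈ X, u ∈ Y → below X u = below Y u ∧ below X u ∈ S

open scoped Classical in
/-- The number of interlaced pairs of subsets of `{0, …, n - 1}` of sizes `a` and `b`. -/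
noncomputable def interlacedCount (S : Finset ℕ) (n a b : ℕ) : ℕ :=
  ∑ X ∈ (range n).powerset, ∑ Y ∈ (range n).powerset,
    if #X = a ∧ #Y = b ∧ Interlaced S X Y then 1 else 0

section Interlaced

variable {S X Y : Finset ℕ} {n : ℕ}

theorem below_insert {u : ℕ} (hu : u ≤ n) : below (insert n X) u = below X u := by
  rw [below, below, filter_insert, if_neg (by omega)]

theorem below_eq_card (hX : X ⊆ range n) : below X n = #X := by
  rw [below, filter_true_of_mem fun x hx => mem_range.1 (hX hx)]

theorem Interlaced.comm : Interlaced S X Y ↔ Interlaced S Y X := by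
  constructor <;> rintro ⟨h1, h2, h3⟩ <;> refine ⟨h2, h1, fun u hx hy => ?_⟩ <;>
  · obtain ⟨h4, h5⟩ := h3 u hy hx
    exact ⟨h4.symm, h4 ▸ h5⟩

theorem interlaced_insert_left (hX : X ⊆ range n) (hY : Y ⊆ range n) :
    Interlaced S (insert n X) Y ↔ #X ∉ S ∧ Interlaced S X Y := by
  have hnX : n ∉ X := fun h => by simpa using hX h
  have hnY : n ∉ Y := fun h => by simpa using hY h
  have hb : ∀ u ∈ X, below (insert n X) u = below X u := fun u hu =>
    below_insert (mem_range.1 (hX hu)).le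
  have hbn : below (insert n X) n = #X := by rw [below_insert le_rfl, below_eq_card hX]
  constructor
  · rintro ⟨h1, h2, h3⟩
    refine ⟨fun h => hnY (h1 n (mem_insert_self _ _) (hbn ▸ h)), fun u hu h => ?_,
      fun u hu h => ?_, fun u hx hy => ?_⟩
    · exact h1 u (mem_insert_of_mem hu) (hb u hu ▸ h)
    · exact (mem_insert.1 (h2 u hu h)).resolve_left fun e => hnY (e ▸ hu)
    · rw [← hb u hx]; exact h3 u (mem_insert_of_mem hx) hy
  · rintro ⟨h0, h1, h2, h3⟩
    refine ⟨fun u hu h => ?_, fun u hu h => mem_insert_of_mem (h2 u hu h), fun u hx hy => ?_⟩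
    · rcases mem_insert.1 hu with rfl | hu
      · exact absurd (hbn ▸ h) h0
      · exact h1 u hu (hb u hu ▸ h)
    · rcases mem_insert.1 hx with rfl | hx
      · exact absurd hy hnY
      · rw [hb u hx]; exact h3 u hx hy

theorem interlaced_insert_right (hX : X ⊆ range n) (hY : Y ⊆ range n) :
    Interlaced S X (insert n Y) ↔ #Y ∉ S ∧ Interlaced S X Y := by
  rw [Interlaced.comm, interlaced_insert_left hY hX, Interlaced.comm]

theorem interlaced_insert_insert (hX : X ⊆ range n) (hY : Y ⊆ range n) :
    Interlaced S (insert n X) (insert n Y) ↔ (#X = #Y ∧ #X ∈ S) ∧ Interlaced S X Y := by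
  have hnX : n ∉ X := fun h => by simpa using hX h
  have hnY : n ∉ Y := fun h => by simpa using hY h
  have hbX : ∀ u ∈ X, below (insert n X) u = below X u := fun u hu =>
    below_insert (mem_range.1 (hX hu)).le
  have hbY : ∀ u ∈ Y, below (insert n Y) u = below Y u := fun u hu =>
    below_insert (mem_range.1 (hY hu)).le
  have hX' : below (insert n X) n = #X := by rw [below_insert le_rfl, below_eq_card hX]
  have hY' : below (insert n Y) n = #Y := by rw [below_insert le_rfl, below_eq_card hY]
  constructor
  · rintro ⟨h1, h2, h3⟩
    refine ⟨?_, fun u hu h => ?_, fun u hu h => ?_, fun u hx hy => ?_⟩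
    · rw [← hX', ← hY']; exact h3 n (mem_insert_self _ _) (mem_insert_self _ _)
    · exact (mem_insert.1 (h1 u (mem_insert_of_mem hu) (hbX u hu ▸ h))).resolve_left
        fun e => hnX (e ▸ hu)
    · exact (mem_insert.1 (h2 u (mem_insert_of_mem hu) (hbY u hu ▸ h))).resolve_left
        fun e => hnY (e ▸ hu)
    · rw [← hbX u hx, ← hbY u hy]
      exact h3 u (mem_insert_of_mem hx) (mem_insert_of_mem hy)
  · rintro ⟨h0, h1, h2, h3⟩
    refine ⟨fun u hu h => ?_, fun u hu h => ?_, fun u hx hy => ?_⟩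
    · rcases mem_insert.1 hu with rfl | hu
      · exact mem_insert_self _ _
      · exact mem_insert_of_mem (h1 u hu (hbX u hu ▸ h))
    · rcases mem_insert.1 hu with rfl | hu
      · exact mem_insert_self _ _
      · exact mem_insert_of_mem (h2 u hu (hbY u hu ▸ h))
    · rcases mem_insert.1 hx with rfl | hx <;> rcases mem_insert.1 hy with hy | hy
      · rw [hX', hY']; exact h0
      · exact absurd hy hnY
      · exact absurd (hy ▸ hx) hnX
      · rw [hbX u hx, hbY u hy]; exact h3 u hx hy

theorem interlacedCount_zero (S : Finset ℕ) (a b : ℕ) :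
    interlacedCount S 0 a b = if a = 0 ∧ b = 0 then 1 else 0 := by
  simp only [interlacedCount, range_zero, powerset_empty, sum_singleton, card_empty]
  simp [Interlaced, eq_comm (a := 0)]

theorem interlacedCount_succ (S : Finset ℕ) (n a b : ℕ) :
    interlacedCount S (n + 1) a b = interlacedCount S n a b +
      (if 0 < b ∧ b - 1 ∉ S then interlacedCount S n a (b - 1) else 0) +
      (if 0 < a ∧ a - 1 ∉ S then interlacedCount S n (a - 1) b else 0) +
      (if 0 < a ∧ a = b ∧ a - 1 ∈ S then interlacedCount S n (a - 1) (b - 1) else 0) := by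
  classical
  have hn : n ∉ range n := by simp
  simp only [interlacedCount]
  rw [range_add_one, sum_powerset_insert hn]
  simp only [sum_powerset_insert hn, sum_add_distrib]
  rw [add_assoc, ← add_assoc]
  have mul : ∀ (p : Prop) [Decidable p] (f : Finset ℕ → Finset ℕ → ℕ),
      (if p then ∑ X ∈ (range n).powerset, ∑ Y ∈ (range n).powerset, f X Y else 0) =
        ∑ X ∈ (range n).powerset, ∑ Y ∈ (range n).powerset, if p then f X Y else 0 := by
    intro p _ f; split_ifs <;> simp
  have ite_iff : ∀ {p q : Prop} [Decidable p] [Decidable q], (p ↔ q) →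
      (if p then 1 else 0 : ℕ) = if q then 1 else 0 := fun h => by simp only [h]
  rw [mul, mul, mul, ← add_assoc]
  congr 1
  · congr 1
    · congr 1
      refine sum_congr rfl fun X hX => sum_congr rfl fun Y hY => ?_
      rw [mem_powerset] at hX hY
      have hnY : n ∉ Y := fun h => hn (hY h)
      rw [← ite_and]
      refine ite_iff ?_
      rw [interlaced_insert_right hX hY, card_insert_of_notMem hnY]
      constructor
      · rintro ⟨h1, rfl, h3, h4⟩
        exact ⟨⟨by omega, by simpa using h3⟩, h1, by omega, h4⟩
      · rintro ⟨⟨h1, h2⟩, h3, h4, h5⟩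
        exact ⟨h3, by omega, h4 ▸ h2, h5⟩
    · refine sum_congr rfl fun X hX => sum_congr rfl fun Y hY => ?_
      rw [mem_powerset] at hX hY
      have hnX : n ∉ X := fun h => hn (hX h)
      rw [← ite_and]
      refine ite_iff ?_
      rw [interlaced_insert_left hX hY, card_insert_of_notMem hnX]
      constructor
      · rintro ⟨rfl, h1, h3, h4⟩
        exact ⟨⟨by omega, by simpa using h3⟩, by omega, h1, h4⟩
      · rintro ⟨⟨h1, h2⟩, h3, h4, h5⟩
        exact ⟨by omega, h4, h3 ▸ h2, h5⟩
  · refine sum_congr rfl fun X hX => sum_congr rfl fun Y hY => ?_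
    rw [mem_powerset] at hX hY
    have hnX : n ∉ X := fun h => hn (hX h)
    have hnY : n ∉ Y := fun h => hn (hY h)
    rw [← ite_and]
    refine ite_iff ?_
    rw [interlaced_insert_insert hX hY, card_insert_of_notMem hnX, card_insert_of_notMem hnY]
    constructor
    · rintro ⟨rfl, rfl, ⟨h1, h2⟩, h3⟩
      exact ⟨⟨by omega, by omega, by simpa using h2⟩, by omega, by omega, h3⟩
    · rintro ⟨⟨h1, h2, h3⟩, h4, h5, h6⟩
      exact ⟨by omega, by omega, ⟨by omega, h4 ▸ h3⟩, h6⟩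

theorem below_succ_of_mem {a : ℕ} (h : a ∈ S) : below S (a + 1) = below S a + 1 := by
  have : ({x ∈ S | x < a + 1} : Finset ℕ) = insert a {x ∈ S | x < a} := by
    ext x; simp only [mem_filter, mem_insert]; constructor
    · rintro ⟨h1, h2⟩
      rcases Nat.lt_succ_iff_lt_or_eq.1 h2 with h' | h'
      · exact Or.inr ⟨h1, h'⟩
      · exact Or.inl h'
    · rintro (rfl | h')
      · exact ⟨h, by omega⟩
      · exact ⟨h'.1, by omega⟩
  rw [below, this, card_insert_of_notMem (by simp), below]

theorem below_succ_of_notMem {a : ℕ} (h : a ∉ S) : below S (a + 1) = below S a := by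
  rw [below, below]
  congr 1
  ext x; simp only [mem_filter]
  refine and_congr_right fun hx => ?_
  have : x ≠ a := fun e => h (e ▸ hx)
  omega

theorem below_le (S : Finset ℕ) (a : ℕ) : below S a ≤ a := by
  have : ({x ∈ S | x < a} : Finset ℕ) ⊆ range a := fun x hx => by
    simpa using (mem_filter.1 hx).2
  simpa [below] using card_le_card this

theorem interlacedCount_eq (S : Finset ℕ) (n a b : ℕ) :
    interlacedCount S n a b =
      n.choose (a + b - below S (min a b)) * pathCount S a b := by
  induction n generalizing a b with
  | zero =>
    rw [interlacedCount_zero]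
    split_ifs with h
    · obtain ⟨rfl, rfl⟩ := h
      simp [pathCount.eq_1, below]
    · have := below_le S (min a b)
      rw [Nat.choose_eq_zero_of_lt (by omega), zero_mul]
  | succ n ih =>
    rw [interlacedCount_succ]
    simp only [ih]
    rcases a with _ | a <;> rcases b with _ | b
    · simp [below]
    · by_cases hb : b ∈ S
      · simp [pathCount.eq_3, hb]
      · simp [pathCount.eq_3, hb, below, Nat.choose_succ_succ']; ring
    · by_cases ha : a ∈ S
      · simp [pathCount.eq_2, ha]
      · simp [pathCount.eq_2, ha, below, Nat.choose_succ_succ']; ring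
    · have hle := below_le S (min (a + 1) (b + 1))
      obtain ⟨N, hN⟩ : ∃ N, a + 1 + (b + 1) - below S (min (a + 1) (b + 1)) = N + 1 :=
        ⟨a + 1 + b - below S (min (a + 1) (b + 1)), by omega⟩
      rw [hN, Nat.choose_succ_succ', pathCount.eq_4]
      simp only [Nat.add_sub_cancel, Nat.succ_pos, true_and, Nat.add_right_cancel_iff]
      have hA : a ∉ S → a + (b + 1) - below S (min a (b + 1)) = N := by
        intro ha
        rcases le_or_gt a b with h | h
        · rw [min_eq_left (by omega), below_succ_of_notMem ha] at hN
          rw [min_eq_left (by omega)]; have := below_le S a; omega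
        · rw [min_eq_right (by omega)] at hN ⊢
          have := below_le S (b + 1); omega
      have hB : b ∉ S → a + 1 + b - below S (min (a + 1) b) = N := by
        intro hb
        rcases le_or_gt b a with h | h
        · rw [min_eq_right (by omega), below_succ_of_notMem hb] at hN
          rw [min_eq_right (by omega)]; have := below_le S b; omega
        · rw [min_eq_left (by omega)] at hN ⊢
          have := below_le S (a + 1); omega
      have hC : a = b ∧ a ∈ S → a + b - below S (min a b) = N := by
        rintro ⟨rfl, ha⟩
        rw [min_self, below_succ_of_mem ha] at hN
        rw [min_self]; have := below_le S a; omega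
      have e1 : (if a ∉ S then n.choose (a + (b + 1) - below S (min a (b + 1))) *
          pathCount S a (b + 1) else 0) =
          n.choose N * (if a ∈ S then 0 else pathCount S a (b + 1)) := by
        by_cases ha : a ∈ S
        · simp [ha]
        · rw [if_pos ha, if_neg ha, hA ha]
      have e2 : (if b ∉ S then n.choose (a + 1 + b - below S (min (a + 1) b)) *
          pathCount S (a + 1) b else 0) =
          n.choose N * (if b ∈ S then 0 else pathCount S (a + 1) b) := by
        by_cases hb : b ∈ S
        · simp [hb]
        · rw [if_pos hb, if_neg hb, hB hb]
      have e3 : (if a = b ∧ a ∈ S then n.choose (a + b - below S (min a b)) *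
          pathCount S a b else 0) =
          n.choose N * (if a = b ∧ a ∈ S then pathCount S a b else 0) := by
        by_cases h : a = b ∧ a ∈ S
        · rw [if_pos h, if_pos h, hC h]
        · rw [if_neg h, if_neg h, mul_zero]
      rw [e1, e2, e3]
      ring

end Interlaced

section Labelings

variable {n k t : ℕ} {π : Pattern k} {v w : Fin k → Fin n}

/-- The labels `v` are in the same relative order as `π`. -/
def SameOrder (π : Pattern k) (v : Fin k → Fin n) : Prop :=
  ∀ i j : Fin k, v i < v j ↔ π i < π j

/-- `v` and `w` coincide in exactly the first `t` entries and are otherwise disjoint. -/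
def Fork (t : ℕ) (v w : Fin k → Fin n) : Prop :=
  ∀ p q : Fin k, v p = w q ↔ p = q ∧ (p : ℕ) < t

/-- The set `{π(1), …, π(t)}`, 0-indexed. -/
def prefixValues (π : Pattern k) (t : ℕ) : Finset ℕ :=
  ({j : Fin k | (j : ℕ) < t} : Finset (Fin k)).image fun j => (π j : ℕ)

/-- The set of labels appearing in `v`. -/
def labels (v : Fin k → Fin n) : Finset ℕ := univ.image fun p => (v p : ℕ)

theorem mem_prefixValues (j : Fin k) : (π j : ℕ) ∈ prefixValues π t ↔ (j : ℕ) < t := by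
  simp [prefixValues, Fin.val_inj]

theorem mem_labels (v : Fin k → Fin n) (p : Fin k) : (v p : ℕ) ∈ labels v :=
  mem_image_of_mem _ (mem_univ p)

theorem exists_of_mem_labels {u : ℕ} (hu : u ∈ labels v) : ∃ p, (v p : ℕ) = u := by
  simpa [labels] using hu

theorem labels_subset (v : Fin k → Fin n) : labels v ⊆ range n := by
  intro u hu
  obtain ⟨p, rfl⟩ := exists_of_mem_labels hu
  simp

theorem SameOrder.injective (h : SameOrder π v) : Function.Injective v := by
  intro p q hpq
  have h1 := h p q
  have h2 := h q p
  rw [hpq] at h1 h2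
  refine π.injective (le_antisymm ?_ ?_)
  · simpa using h2
  · simpa using h1

theorem SameOrder.card_labels (h : SameOrder π v) : #(labels v) = k := by
  rw [labels]
  exact (card_image_of_injective _ (Fin.val_injective.comp h.injective)).trans (by simp)

theorem SameOrder.below_labels (h : SameOrder π v) (p : Fin k) :
    below (labels v) (v p) = π p := by
  have h1 : ({x ∈ labels v | x < (v p : ℕ)} : Finset ℕ) =
      (Iio (π p)).image fun q => (v (π.symm q) : ℕ) := by
    ext x
    simp only [mem_filter, mem_image, mem_Iio]
    constructor
    · rintro ⟨hx, hlt⟩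
      obtain ⟨q, rfl⟩ := exists_of_mem_labels hx
      exact ⟨π q, (h q p).1 hlt, by simp⟩
    · rintro ⟨q, hq, rfl⟩
      exact ⟨mem_labels v _, (h _ p).2 (by simpa using hq)⟩
  rw [below, h1, card_image_of_injective]
  · simp
  · exact Fin.val_injective.comp (h.injective.comp π.symm.injective)

theorem exists_sameOrder (π : Pattern k) {X : Finset ℕ} (hX : X ⊆ range n) (hk : #X = k) :
    ∃ v : Fin k → Fin n, SameOrder π v ∧ labels v = X := by
  refine ⟨fun p => ⟨X.orderEmbOfFin hk (π p),
    mem_range.1 (hX (orderEmbOfFin_mem X hk _))⟩, fun i j => ?_, ?_⟩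
  · simp
  · ext u
    constructor
    · intro hu
      obtain ⟨p, rfl⟩ := exists_of_mem_labels hu
      exact orderEmbOfFin_mem X hk _
    · intro hu
      have : u ∈ Set.range (X.orderEmbOfFin hk) := by
        rw [range_orderEmbOfFin]; exact hu
      obtain ⟨q, rfl⟩ := this
      simp only [labels, mem_image, mem_univ, true_and]
      exact ⟨π.symm q, by simp⟩

theorem SameOrder.eq_of_labels_eq (hv : SameOrder π v) (hw : SameOrder π w)
    (h : labels v = labels w) : v = w := by
  funext p
  obtain ⟨q, hq⟩ := exists_of_mem_labels (h ▸ mem_labels v p)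
  have h1 := hv.below_labels p
  rw [h, ← hq, hw.below_labels q] at h1
  have : q = p := π.injective (Fin.ext h1)
  exact Fin.ext (this ▸ hq.symm)

theorem SameOrder.fork_iff (hv : SameOrder π v) (hw : SameOrder π w) :
    Fork t v w ↔ Interlaced (prefixValues π t) (labels v) (labels w) := by
  constructor
  · intro h
    refine ⟨fun u hu hS => ?_, fun u hu hS => ?_, fun u hu hu' => ?_⟩
    · obtain ⟨p, rfl⟩ := exists_of_mem_labels hu
      rw [hv.below_labels, mem_prefixValues] at hS
      rw [(h p p).2 ⟨rfl, hS⟩]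
      exact mem_labels w p
    · obtain ⟨p, rfl⟩ := exists_of_mem_labels hu
      rw [hw.below_labels, mem_prefixValues] at hS
      rw [← (h p p).2 ⟨rfl, hS⟩]
      exact mem_labels v p
    · obtain ⟨p, rfl⟩ := exists_of_mem_labels hu
      obtain ⟨q, hq⟩ := exists_of_mem_labels hu'
      have hpq := Fin.ext hq.symm
      obtain ⟨rfl, ht⟩ := (h p q).1 hpq
      rw [hv.below_labels, mem_prefixValues, hpq, hw.below_labels]
      exact ⟨rfl, ht⟩
  · rintro ⟨h1, -, h3⟩ p q
    have key : ∀ p q, v p = w q → p = q ∧ (p : ℕ) < t := by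
      intro p q hpq
      obtain ⟨h4, h5⟩ := h3 (v p) (mem_labels v p) (by rw [hpq]; exact mem_labels w q)
      rw [hv.below_labels, mem_prefixValues] at h5
      rw [hv.below_labels, hpq, hw.below_labels] at h4
      exact ⟨π.injective (Fin.ext h4), h5⟩
    refine ⟨key p q, ?_⟩
    rintro ⟨rfl, ht⟩
    obtain ⟨q, hq⟩ := exists_of_mem_labels (h1 (v p) (mem_labels v p)
      (by rw [hv.below_labels, mem_prefixValues]; exact ht))
    have hpq := Fin.ext hq.symm
    rw [hpq, ← (key p q hpq).1]

open scoped Classical in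
/-- The pairs of labelings ordered like `π` that coincide in exactly the first `t` entries. -/
noncomputable def forkPairs (π : Pattern k) (n t : ℕ) :
    Finset ((Fin k → Fin n) × (Fin k → Fin n)) :=
  {p | (SameOrder π p.1 ∧ SameOrder π p.2) ∧ Fork t p.1 p.2}

theorem mem_forkPairs {p : (Fin k → Fin n) × (Fin k → Fin n)} :
    p ∈ forkPairs π n t ↔ (SameOrder π p.1 ∧ SameOrder π p.2) ∧ Fork t p.1 p.2 := by
  simp [forkPairs]

theorem card_forkPairs_eq_interlacedCount (π : Pattern k) (n t : ℕ) :
    #(forkPairs π n t) = interlacedCount (prefixValues π t) n k k := by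
  classical
  rw [interlacedCount, ← sum_product', ← card_filter]
  refine card_bij (fun p _ => (labels p.1, labels p.2)) ?_ ?_ ?_
  · rintro ⟨v, w⟩ h
    obtain ⟨⟨hv, hw⟩, hf⟩ := mem_forkPairs.1 h
    simp only [mem_filter, mem_product, mem_powerset]
    exact ⟨⟨labels_subset v, labels_subset w⟩, hv.card_labels, hw.card_labels,
      (hv.fork_iff hw).1 hf⟩
  · rintro ⟨v, w⟩ h ⟨v', w'⟩ h' he
    obtain ⟨⟨hv, hw⟩, -⟩ := mem_forkPairs.1 h
    obtain ⟨⟨hv', hw'⟩, -⟩ := mem_forkPairs.1 h'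
    rw [Prod.mk.injEq] at he ⊢
    exact ⟨hv.eq_of_labels_eq hv' he.1, hw.eq_of_labels_eq hw' he.2⟩
  · rintro ⟨X, Y⟩ h
    simp only [mem_filter, mem_product, mem_powerset] at h
    obtain ⟨⟨hX, hY⟩, hXk, hYk, hI⟩ := h
    obtain ⟨v, hv, rfl⟩ := exists_sameOrder π hX hXk
    obtain ⟨w, hw, rfl⟩ := exists_sameOrder π hY hYk
    exact ⟨(v, w), mem_forkPairs.2 ⟨⟨hv, hw⟩, (hv.fork_iff hw).2 hI⟩, rfl⟩

theorem card_prefixValues (π : Pattern k) (ht : t ≤ k) : #(prefixValues π t) = t := by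
  rw [prefixValues]
  refine (card_image_of_injective _ (Fin.val_injective.comp π.injective)).trans ?_
  have : ({j : Fin k | (j : ℕ) < t} : Finset (Fin k)) = univ.image (Fin.castLE ht) := by
    ext j
    simp only [mem_filter, mem_univ, true_and, mem_image]
    constructor
    · intro h; exact ⟨⟨j, h⟩, rfl⟩
    · rintro ⟨i, rfl⟩; simp
  rw [this, card_image_of_injective _ (Fin.castLE_injective ht)]
  simp

theorem prefixValues_subset (π : Pattern k) (t : ℕ) : prefixValues π t ⊆ range k := by
  intro x hx
  obtain ⟨j, -, rfl⟩ := mem_image.1 hx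
  simp

theorem card_forkPairs (π : Pattern k) (n : ℕ) (ht : t ≤ k) :
    #(forkPairs π n t) =
      n.choose (2 * k - t) * pathCount (prefixValues π t) k k := by
  rw [card_forkPairs_eq_interlacedCount, interlacedCount_eq, min_self,
    below_eq_card (prefixValues_subset π t), card_prefixValues π ht, two_mul]

end Labelings

section Paths

variable {n k t : ℕ} {v w : Fin k → Fin n}

/-- `v` is a downward path of `F`. -/
def IsPath (F : RForest n) (v : Fin k → Fin n) : Prop :=
  ∀ i j : Fin k, (j : ℕ) = (i : ℕ) + 1 → F.parent (v j) = some (v i)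

theorem parent_injective : Function.Injective (parent : RForest n → Fin n → Option (Fin n)) := by
  rintro ⟨f, _⟩ ⟨g, _⟩ h
  cases h
  rfl

instance : Finite (RForest n) := Finite.of_injective _ parent_injective

/-- Rename the vertices of `F` by `σ`. -/
def relabel (σ : Equiv.Perm (Fin n)) (F : RForest n) : RForest n where
  parent u := (F.parent (σ.symm u)).map σ
  acyclic u h := by
    refine F.acyclic (σ.symm u) (h.lift σ.symm fun a b hab => ?_)
    obtain ⟨c, hc, rfl⟩ := Option.map_eq_some_iff.1 hab
    simpa [Function.onFun] using hc

theorem relabel_injective (σ : Equiv.Perm (Fin n)) : Function.Injective (relabel σ) := by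
  intro F G h
  apply parent_injective
  funext u
  have := congrFun (congrArg parent h) (σ u)
  simp only [relabel, Equiv.symm_apply_apply] at this
  exact Option.map_injective σ.injective this

theorem IsPath.relabel {F : RForest n} (h : IsPath F v) (σ : Equiv.Perm (Fin n)) :
    IsPath (F.relabel σ) (σ ∘ v) := by
  intro i j hij
  simp [RForest.relabel, h i j hij]

/-- The number of forests in which `v` and `w` are both downward paths. -/
noncomputable def pathForestCount (v w : Fin k → Fin n) : ℕ :=
  Nat.card {F : RForest n // IsPath F v ∧ IsPath F w}

theorem pathForestCount_le (σ : Equiv.Perm (Fin n)) (v w : Fin k → Fin n) :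
    pathForestCount v w ≤ pathForestCount (σ ∘ v) (σ ∘ w) := by
  refine Nat.card_le_card_of_injective
    (fun F => ⟨F.1.relabel σ, F.2.1.relabel σ, F.2.2.relabel σ⟩) ?_
  intro F G h
  exact Subtype.ext (relabel_injective σ (congrArg Subtype.val h))

theorem exists_perm_comp_eq {α : Type*} {f g : α → Fin n} (h : ∀ x y, f x = f y ↔ g x = g y) :
    ∃ σ : Equiv.Perm (Fin n), σ ∘ f = g := by
  classical
  let e : Set.range f ≃ Set.range g := Equiv.ofBijective
    (fun u => ⟨g u.2.choose, u.2.choose, rfl⟩) <| by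
      constructor
      · intro u u' huu
        have h1 : g u.2.choose = g u'.2.choose := congrArg Subtype.val huu
        rw [← h, u.2.choose_spec, u'.2.choose_spec] at h1
        exact Subtype.ext h1
      · rintro ⟨_, x, rfl⟩
        refine ⟨⟨f x, x, rfl⟩, Subtype.ext ?_⟩
        have hx : ∃ y, f y = f x := ⟨x, rfl⟩
        exact (h _ _).1 hx.choose_spec
  refine ⟨Equiv.extendSubtype (p := (· ∈ Set.range f)) (q := (· ∈ Set.range g)) e, ?_⟩
  funext x
  have hx : ∃ y, f y = f x := ⟨x, rfl⟩
  have := Equiv.extendSubtype_apply_of_mem (p := (· ∈ Set.range f)) (q := (· ∈ Set.range g))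
    e (f x) ⟨x, rfl⟩
  rw [Function.comp_apply, this]
  exact (h _ _).1 hx.choose_spec

theorem Fork.pathForestCount_le {v' w' : Fin k → Fin n} (hv : Function.Injective v)
    (hw : Function.Injective w) (hv' : Function.Injective v') (hw' : Function.Injective w')
    (h : Fork t v w) (h' : Fork t v' w') : pathForestCount v w ≤ pathForestCount v' w' := by
  obtain ⟨σ, hσ⟩ := exists_perm_comp_eq (f := Sum.elim v w) (g := Sum.elim v' w') <| by
    have h2 : ∀ p q, w p = v q ↔ w' p = v' q := fun p q => by
      rw [eq_comm, h q p, eq_comm (a := w' p), h' q p]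
    rintro (p | p) (q | q)
    · simp [hv.eq_iff, hv'.eq_iff]
    · simp [h p q, h' p q]
    · simpa using h2 p q
    · simp [hw.eq_iff, hw'.eq_iff]
  have e1 : σ ∘ v = v' := funext fun p => congrFun hσ (Sum.inl p)
  have e2 : σ ∘ w = w' := funext fun p => congrFun hσ (Sum.inr p)
  rw [← e1, ← e2]
  exact RForest.pathForestCount_le σ v w

theorem Fork.pathForestCount_pos (hv : Function.Injective v) (hw : Function.Injective w)
    (h : Fork t v w) : 0 < pathForestCount v w := by
  classical
  let R : Fin n → Fin n → Prop := fun a b => ∃ i j : Fin k, (j : ℕ) = i + 1 ∧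
    ((v i = a ∧ v j = b) ∨ (w i = a ∧ w j = b))
  have hR : ∀ a a' b, R a b → R a' b → a = a' := by
    rintro a a' b ⟨i, j, hij, hb⟩ ⟨i', j', hij', hb'⟩
    have hjj : ∀ {i i' j j' : Fin k}, (j : ℕ) = i + 1 → (j' : ℕ) = i' + 1 → j = j' → i = i' := by
      rintro i i' j j' h1 h2 rfl
      exact Fin.ext (by omega)
    rcases hb with ⟨rfl, rfl⟩ | ⟨rfl, rfl⟩ <;> rcases hb' with ⟨rfl, hb'⟩ | ⟨rfl, hb'⟩
    · rw [hjj hij hij' (hv hb').symm]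
    · obtain ⟨hj, hlt⟩ := (h j j').1 hb'.symm
      exact (h i i').2 ⟨hjj hij hij' hj, by omega⟩
    · obtain ⟨hj, hlt⟩ := (h j' j).1 hb'
      exact ((h i' i).2 ⟨hjj hij' hij hj, by omega⟩).symm
    · rw [hjj hij hij' (hw hb').symm]
  let lvl : Fin n → ℕ := fun u =>
    if hu : ∃ p, v p = u then hu.choose else if hu : ∃ p, w p = u then hu.choose else 0
  have lv : ∀ p, lvl (v p) = p := fun p => by
    have hu : ∃ q, v q = v p := ⟨p, rfl⟩
    simp only [lvl, dif_pos hu]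
    rw [hv hu.choose_spec]
  have lw : ∀ p, lvl (w p) = p := fun p => by
    by_cases hu : ∃ q, v q = w p
    · simp only [lvl, dif_pos hu]
      rw [((h _ _).1 hu.choose_spec).1]
    · have hu' : ∃ q, w q = w p := ⟨p, rfl⟩
      simp only [lvl, dif_neg hu, dif_pos hu']
      rw [hw hu'.choose_spec]
  have hlvl : ∀ a b, R a b → lvl a < lvl b := by
    rintro a b ⟨i, j, hij, ⟨rfl, rfl⟩ | ⟨rfl, rfl⟩⟩
    · rw [lv, lv]; omega
    · rw [lw, lw]; omega
  let par : Fin n → Option (Fin n) := fun b => if hb : ∃ a, R a b then some hb.choose else none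
  have hpar : ∀ a b, par b = some a ↔ R a b := by
    intro a b
    by_cases hb : ∃ a, R a b
    · simp only [par, dif_pos hb, Option.some.injEq]
      exact ⟨fun e => e ▸ hb.choose_spec, fun hab => hR _ _ b hb.choose_spec hab⟩
    · simp only [par, dif_neg hb, reduceCtorEq, false_iff]
      exact fun hab => hb ⟨a, hab⟩
  let F : RForest n := ⟨par, fun u hu => by
    have : ∀ a b, Relation.TransGen (fun a b => par b = some a) a b → lvl a < lvl b := by
      intro a b hab
      induction hab with
      | single hab => exact hlvl _ _ ((hpar _ _).1 hab)
      | tail _ hab ih => exact ih.trans (hlvl _ _ ((hpar _ _).1 hab))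
    exact lt_irrefl _ (this u u hu)⟩
  have : Nonempty {F : RForest n // IsPath F v ∧ IsPath F w} :=
    ⟨F, fun i j hij => (hpar _ _).2 ⟨i, j, hij, Or.inl ⟨rfl, rfl⟩⟩,
      fun i j hij => (hpar _ _).2 ⟨i, j, hij, Or.inr ⟨rfl, rfl⟩⟩⟩
  exact Nat.card_pos

end Paths

section Overlaps

variable {n k s i : ℕ} {π : Pattern k} {v w : Fin k → Fin n} {F : RForest n}

theorem IsPath.eq_of_add (hv : IsPath F v) (hw : IsPath F w) {p q : Fin k} (h : v p = w q) (r : ℕ)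
    {p' q' : Fin k} (hp : (p' : ℕ) + r = p) (hq : (q' : ℕ) + r = q) : v p' = w q' := by
  induction r generalizing p' q' with
  | zero => rwa [show p' = p from Fin.ext hp, show q' = q from Fin.ext hq]
  | succ r ih =>
    let p₁ : Fin k := ⟨p' + 1, by omega⟩
    let q₁ : Fin k := ⟨q' + 1, by omega⟩
    have h1 : v p₁ = w q₁ := ih (by simp only [p₁]; omega) (by simp only [q₁]; omega)
    have h2 := hv p' p₁ rfl
    rw [h1, hw q' q₁ rfl] at h2
    exact (Option.some.inj h2).symm

open scoped Classical in
theorem le_card_common (hv : Function.Injective v) (hw : Function.Injective w)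
    (hn : n + i ≤ 2 * k) : i ≤ #({p : Fin k | ∃ q, v p = w q} : Finset (Fin k)) := by
  have h1 : univ.image v ∩ univ.image w =
      ({p : Fin k | ∃ q, v p = w q} : Finset (Fin k)).image v := by
    ext u
    simp only [mem_inter, mem_image, mem_univ, true_and, mem_filter]
    constructor
    · rintro ⟨⟨p, rfl⟩, q, hq⟩
      exact ⟨p, ⟨q, hq.symm⟩, rfl⟩
    · rintro ⟨p, ⟨q, hq⟩, rfl⟩
      exact ⟨⟨p, rfl⟩, q, hq.symm⟩
  have h2 := card_union_add_card_inter (univ.image v) (univ.image w)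
  rw [h1, card_image_of_injective _ hv, card_image_of_injective _ hv,
    card_image_of_injective _ hw, card_univ, Fintype.card_fin] at h2
  have h3 : #(univ.image v ∪ univ.image w) ≤ n := by
    simpa using card_le_univ (univ.image v ∪ univ.image w)
  omega

theorem exists_common_ge (hv : Function.Injective v) (hw : Function.Injective w)
    (hn : n + i ≤ 2 * k) (hi : s < i) : ∃ p q : Fin k, v p = w q ∧ s ≤ p := by
  classical
  by_contra! hcon
  have h1 := le_card_common hv hw hn
  have h2 : #({p : Fin k | ∃ q, v p = w q} : Finset (Fin k)) ≤ #(range s) := by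
    rw [← card_image_of_injective _ (Fin.val_injective (n := k))]
    refine card_le_card fun x hx => ?_
    simp only [mem_image, mem_filter, mem_univ, true_and] at hx
    obtain ⟨p, ⟨q, hq⟩, rfl⟩ := hx
    exact mem_range.2 (hcon p q hq)
  rw [card_range] at h2
  omega

theorem heightAt_bddAbove (π : Pattern k) (t : Fin k) :
    BddAbove {m | m ≤ (t : ℕ) ∧ ∀ a b : Fin k, (t : ℕ) < (a : ℕ) + m →
      (b : ℕ) = (a : ℕ) + 1 → (b : ℕ) ≤ (t : ℕ) → π a < π b} :=
  ⟨t, fun _ h => h.1⟩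

theorem heightAt_le_maxHeight (π : Pattern k) {t : Fin k} (ht : 0 < (t : ℕ)) :
    heightAt π t ≤ maxHeight π := by
  refine le_csSup ⟨k, ?_⟩ ⟨t, ht, rfl⟩
  rintro _ ⟨u, -, rfl⟩
  refine csSup_le' fun m hm => ?_
  exact hm.1.trans u.2.le

theorem streak_bddAbove (π : Pattern k) :
    BddAbove {m | m ≤ k ∧ ∀ i : Fin k, (i : ℕ) < m → (π i : ℕ) = (i : ℕ)} :=
  ⟨k, fun _ h => h.1⟩

theorem apply_of_lt_streak (π : Pattern k) (i : Fin k) (hi : (i : ℕ) < streak π) :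
    (π i : ℕ) = i :=
  (Nat.sSup_mem (s := {m | m ≤ k ∧ ∀ i : Fin k, (i : ℕ) < m → (π i : ℕ) = (i : ℕ)})
    ⟨0, by simp⟩ (streak_bddAbove π)).2 i hi

theorem streak_lt_apply (π : Pattern k) (hk : streak π < k) :
    streak π < π ⟨streak π, hk⟩ := by
  by_contra! hle
  rcases hle.lt_or_eq with hlt | heq
  · have h1 := apply_of_lt_streak π (π ⟨streak π, hk⟩) hlt
    have h2 := congrArg Fin.val (π.injective (Fin.ext h1))
    simp only at h2
    omega
  · have : streak π + 1 ≤ streak π := by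
      refine le_csSup (streak_bddAbove π) ⟨hk, fun i hi => ?_⟩
      rcases Nat.lt_succ_iff_lt_or_eq.1 hi with h | h
      · exact apply_of_lt_streak π i h
      · obtain rfl : i = ⟨streak π, hk⟩ := Fin.ext h
        exact heq
    omega

theorem _root_.Grounded.streak_pos (h : Grounded π) : 0 < streak π := by
  have hk : 1 < k := by
    by_contra! hk
    refine h.1 (Equiv.ext fun x => Fin.ext ?_)
    have := (π x).2
    have := x.2
    simp only [Equiv.Perm.coe_one, id_eq]
    omega
  have h1 : 1 ≤ heightAt π ⟨1, hk⟩ :=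
    le_csSup (heightAt_bddAbove π _) ⟨le_rfl, fun a b ha hb hb' => by simp only at *; omega⟩
  have h2 := heightAt_le_maxHeight π (t := ⟨1, hk⟩) Nat.one_pos
  have := h.2
  omega

theorem apply_lt_apply_of_le_streak (π : Pattern k) {x y : Fin k} (hxy : x < y)
    (hy : (y : ℕ) ≤ streak π) : π x < π y := by
  have hxy' : (x : ℕ) < y := hxy
  have hx := apply_of_lt_streak π x (by omega)
  rw [Fin.lt_def, hx]
  rcases hy.lt_or_eq with h | h
  · rw [apply_of_lt_streak π y h]; exact hxy
  · have := streak_lt_apply π (by omega)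
    have hy' : y = ⟨streak π, by omega⟩ := Fin.ext h
    rw [hy']
    omega

/-- If an instance `w` of a grounded pattern starts strictly below the start of another instance
`v`, then their common vertices are among the first `streak π` vertices of `w`. -/
theorem not_shifted_overlap (hg : Grounded π) (hv : SameOrder π v) (hw : SameOrder π w)
    (hFv : IsPath F v) (hFw : IsPath F w) {p q : Fin k} (h : v p = w q) (hqp : q < p)
    (hq : streak π ≤ q) : False := by
  have hqp' : (q : ℕ) < p := hqp
  set d : ℕ := p - q with hd
  have h1 : streak π + 1 ≤ heightAt π ⟨d + streak π, by omega⟩ := by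
    refine le_csSup (heightAt_bddAbove π _) ⟨by simp only; omega, fun a b ha hb hb' => ?_⟩
    simp only at ha hb'
    let a' : Fin k := ⟨a - d, by omega⟩
    let b' : Fin k := ⟨b - d, by omega⟩
    have ea : v a = w a' := hFv.eq_of_add hFw h (p - a) (by omega) (by simp only [a']; omega)
    have eb : v b = w b' := hFv.eq_of_add hFw h (p - b) (by omega) (by simp only [b']; omega)
    rw [← hv, ea, eb, hw]
    exact apply_lt_apply_of_le_streak π (Fin.lt_def.2 (by simp only [a', b']; omega))
      (by simp only [b']; omega)
  have h2 := heightAt_le_maxHeight π (t := ⟨d + streak π, by omega⟩) (by simp only; omega)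
  have := hg.2
  omega

theorem exists_fork (hg : Grounded π) (hv : SameOrder π v) (hw : SameOrder π w)
    (hFv : IsPath F v) (hFw : IsPath F w) (hn : n + i ≤ 2 * k) (hi : streak π < i) :
    ∃ t ∈ Icc i k, Fork t v w := by
  classical
  obtain ⟨p, q, hpq, hp⟩ := exists_common_ge hv.injective hw.injective hn hi
  obtain ⟨q', p', hpq', hq'⟩ := exists_common_ge hw.injective hv.injective hn hi
  have hk : 0 < k := p.pos
  let z : Fin k := ⟨0, hk⟩
  have hz : (π z : ℕ) = 0 := apply_of_lt_streak π z hg.streak_pos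
  have hmin : ∀ {u : Fin k → Fin n}, SameOrder π u → ∀ x, u z ≤ u x := fun {u} hu x => by
    rw [← not_lt, hu, Fin.lt_def, hz]; omega
  have h1 : q ≤ p := not_lt.1 fun hlt => not_shifted_overlap hg hw hv hFw hFv hpq.symm hlt hp
  have h2 : p' ≤ q' := not_lt.1 fun hlt => not_shifted_overlap hg hv hw hFv hFw hpq'.symm hlt hq'
  have h1' : (q : ℕ) ≤ p := h1
  have h2' : (p' : ℕ) ≤ q' := h2
  have h3 : v ⟨p - q, by omega⟩ = w z :=
    hFv.eq_of_add hFw hpq q (by simp only; omega) (by simp [z])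
  have h4 : v z = w ⟨q' - p', by omega⟩ :=
    hFv.eq_of_add hFw hpq'.symm p' (by simp [z]) (by simp only; omega)
  have hzz : v z = w z := by
    refine le_antisymm (h3 ▸ hmin hv _) (h4 ▸ hmin hw _)
  have hdiag : ∀ x y, v x = w y → x = y := by
    intro x y hxy
    rcases le_total x y with hle | hle
    · have hle' : (x : ℕ) ≤ y := hle
      have h5 : v z = w ⟨y - x, by omega⟩ :=
        hFv.eq_of_add hFw hxy x (by simp [z]) (by simp only; omega)
      have h6 := congrArg Fin.val (hw.injective (hzz.symm.trans h5))
      simp only [z] at h6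
      exact Fin.ext (by omega)
    · have hle' : (y : ℕ) ≤ x := hle
      have h5 : v ⟨x - y, by omega⟩ = w z :=
        hFv.eq_of_add hFw hxy y (by simp only; omega) (by simp [z])
      have h6 := congrArg Fin.val (hv.injective (h5.trans hzz.symm))
      simp only [z] at h6
      exact Fin.ext (by omega)
  let I : Finset (Fin k) := {p | ∃ q, v p = w q}
  have hI : I.Nonempty := ⟨z, by simpa [I] using ⟨z, hzz⟩⟩
  obtain ⟨m, hm, hmax⟩ := I.exists_max_image id hI
  have hIm : I ⊆ Iic m := fun x hx => mem_Iic.2 (hmax x hx)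
  have hcard := (le_card_common hv.injective hw.injective hn).trans (card_le_card hIm)
  rw [Fin.card_Iic] at hcard
  refine ⟨m + 1, mem_Icc.2 ⟨hcard, m.2⟩, fun x y => ⟨fun hxy => ⟨hdiag x y hxy, ?_⟩, ?_⟩⟩
  · have hx : x ∈ I := by simpa [I] using ⟨y, hxy⟩
    have : x ≤ m := hmax x hx
    exact Nat.lt_succ_of_le this
  · rintro ⟨rfl, hx⟩
    obtain ⟨y, hy⟩ : ∃ y, v m = w y := by simpa [I] using hm
    obtain rfl := hdiag m y hy
    exact hFv.eq_of_add hFw hy (m - x) (by omega) (by omega)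

theorem Fork.unique {t t' : ℕ} (ht : t ≤ k) (ht' : t' ≤ k) (h : Fork t v w) (h' : Fork t' v w) :
    t = t' := by
  have key : ∀ {t t' : ℕ}, t' ≤ k → Fork t v w → Fork t' v w → t' ≤ t := by
    intro t t' ht' h h'
    by_contra! hlt
    have := (h' ⟨t, by omega⟩ ⟨t, by omega⟩).2 ⟨rfl, hlt⟩
    exact lt_irrefl _ ((h _ _).1 this).2
  exact le_antisymm (key ht h' h) (key ht' h h')

end Overlaps

section Counting

variable {n k i : ℕ} {π π' : Pattern k}

noncomputable instance : Fintype (RForest n) := Fintype.ofFinite _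

/-- The number of consecutive instances of `π` in `F`. -/
noncomputable def instanceCount (π : Pattern k) (F : RForest n) : ℕ :=
  Nat.card {v : Fin k → Fin n // IsConsInstance F π v}

theorem sum_comp_instanceCount_eq (h : StrongCEquiv π π') (n : ℕ) (g : ℕ → ℕ) :
    ∑ F : RForest n, g (instanceCount π F) = ∑ F : RForest n, g (instanceCount π' F) := by
  classical
  let B : Finset ℕ := univ.image (fun F : RForest n => instanceCount π F) ∪
    univ.image (fun F : RForest n => instanceCount π' F)
  have key : ∀ ρ : Pattern k, (∀ F : RForest n, instanceCount ρ F ∈ B) →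
      ∑ F : RForest n, g (instanceCount ρ F) = ∑ m ∈ B, strongCount ρ n m * g m := by
    intro ρ hρ
    rw [← sum_fiberwise_of_maps_to' (t := B) (g := fun F => instanceCount ρ F)
      (fun F _ => hρ F) g]
    refine sum_congr rfl fun m _ => ?_
    rw [sum_const, smul_eq_mul, strongCount, Nat.card_eq_fintype_card, Fintype.card_subtype]
    rfl
  rw [key π fun F => mem_union_left _ (mem_image_of_mem _ (mem_univ F)),
    key π' fun F => mem_union_right _ (mem_image_of_mem _ (mem_univ F))]
  exact sum_congr rfl fun m _ => by rw [h m n]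

open scoped Classical in
theorem sum_instanceCount_sq (π : Pattern k) (n : ℕ) :
    ∑ F : RForest n, instanceCount π F ^ 2 =
      ∑ p : (Fin k → Fin n) × (Fin k → Fin n) with SameOrder π p.1 ∧ SameOrder π p.2,
        pathForestCount p.1 p.2 := by
  have h1 : ∀ F : RForest n, instanceCount π F ^ 2 =
      ∑ p : (Fin k → Fin n) × (Fin k → Fin n) with SameOrder π p.1 ∧ SameOrder π p.2,
        if IsPath F p.1 ∧ IsPath F p.2 then 1 else 0 := by
    intro F
    rw [instanceCount, Nat.card_eq_fintype_card, Fintype.card_subtype, sq, ← card_product,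
      ← card_filter, filter_filter]
    congr 1
    ext ⟨v, w⟩
    simp only [mem_product, mem_filter, mem_univ, true_and]
    exact ⟨fun ⟨⟨a, b⟩, c, d⟩ => ⟨⟨b, d⟩, a, c⟩, fun ⟨⟨b, d⟩, a, c⟩ => ⟨⟨a, b⟩, c, d⟩⟩
  simp only [h1]
  rw [sum_comm]
  refine sum_congr rfl fun p _ => ?_
  rw [← card_filter, pathForestCount, Nat.card_eq_fintype_card, Fintype.card_subtype]

theorem sum_instanceCount_sq_eq_sum_forkPairs (hg : Grounded π) (hn : n + i ≤ 2 * k)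
    (hi : streak π < i) :
    ∑ F : RForest n, instanceCount π F ^ 2 =
      ∑ t ∈ Icc i k, ∑ p ∈ forkPairs π n t, pathForestCount p.1 p.2 := by
  classical
  rw [sum_instanceCount_sq]
  have h1 : ∀ t, forkPairs π n t =
      {p ∈ ({p | SameOrder π p.1 ∧ SameOrder π p.2} :
        Finset ((Fin k → Fin n) × (Fin k → Fin n))) | Fork t p.1 p.2} := by
    intro t
    ext p
    simp [mem_forkPairs]
  simp only [h1, sum_filter (fun p : (Fin k → Fin n) × (Fin k → Fin n) => Fork _ p.1 p.2)]
  rw [sum_comm]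
  refine sum_congr rfl fun p hp => ?_
  simp only [mem_filter, mem_univ, true_and] at hp
  rcases Nat.eq_zero_or_pos (pathForestCount p.1 p.2) with h0 | h0
  · simp [h0]
  · obtain ⟨⟨F, hFv, hFw⟩⟩ := (Nat.card_pos_iff.1 h0).1
    obtain ⟨t, ht, hf⟩ := exists_fork hg hp.1 hp.2 hFv hFw hn hi
    rw [sum_eq_single_of_mem t ht, if_pos hf]
    intro t' ht' hne
    exact if_neg fun hf' => hne (hf'.unique (mem_Icc.1 ht').2 (mem_Icc.1 ht).2 hf)

theorem exists_pathForestCount_eq (n k t : ℕ) :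
    ∃ W : ℕ, 0 < W ∧ ∀ v w : Fin k → Fin n, Function.Injective v → Function.Injective w →
      Fork t v w → pathForestCount v w = W := by
  by_cases h : ∃ v w : Fin k → Fin n, Function.Injective v ∧ Function.Injective w ∧ Fork t v w
  · obtain ⟨v, w, hv, hw, hf⟩ := h
    exact ⟨pathForestCount v w, hf.pathForestCount_pos hv hw, fun v' w' hv' hw' hf' =>
      le_antisymm (hf'.pathForestCount_le hv' hw' hv hw hf)
        (hf.pathForestCount_le hv hw hv' hw' hf')⟩
  · exact ⟨1, one_pos, fun v w hv hw hf => absurd ⟨v, w, hv, hw, hf⟩ h⟩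

theorem pathCount_prefixValues_eq (hπ : Grounded π) (hπ' : Grounded π') (h : StrongCEquiv π π')
    (hs : streak π = streak π') {t : ℕ} (hst : streak π < t) (htk : t ≤ k) :
    pathCount (prefixValues π t) k k = pathCount (prefixValues π' t) k k := by
  induction hj : k - t using Nat.strong_induction_on generalizing t with
  | _ j ih =>
  choose W hW0 hW using exists_pathForestCount_eq (2 * k - t) k
  have hsum : ∀ ρ : Pattern k, ∀ u ∈ Icc t k,
      ∑ p ∈ forkPairs ρ (2 * k - t) u, pathForestCount p.1 p.2 =
        (2 * k - t).choose (2 * k - u) * pathCount (prefixValues ρ u) k k * W u := by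
    intro ρ u hu
    rw [← card_forkPairs ρ _ (mem_Icc.1 hu).2, ← smul_eq_mul]
    refine sum_eq_card_nsmul fun p hp => ?_
    obtain ⟨⟨hv, hw⟩, hf⟩ := mem_forkPairs.1 hp
    exact hW u _ _ hv.injective hw.injective hf
  have key : ∑ F : RForest (2 * k - t), instanceCount π F ^ 2 =
      ∑ F : RForest (2 * k - t), instanceCount π' F ^ 2 :=
    sum_comp_instanceCount_eq h _ (· ^ 2)
  rw [sum_instanceCount_sq_eq_sum_forkPairs hπ (i := t) (by omega) hst,
    sum_instanceCount_sq_eq_sum_forkPairs hπ' (i := t) (by omega) (hs ▸ hst),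
    sum_congr rfl (hsum π), sum_congr rfl (hsum π')] at key
  have ht : t ∈ Icc t k := mem_Icc.2 ⟨le_rfl, htk⟩
  rw [← add_sum_erase _ _ ht, ← add_sum_erase _ _ ht] at key
  have hrest : ∀ u ∈ (Icc t k).erase t,
      (2 * k - t).choose (2 * k - u) * pathCount (prefixValues π u) k k * W u =
        (2 * k - t).choose (2 * k - u) * pathCount (prefixValues π' u) k k * W u := by
    intro u hu
    simp only [mem_erase, mem_Icc] at hu
    rw [ih (k - u) (by omega) (by omega) (by omega) rfl]
  rw [sum_congr rfl hrest, Nat.add_right_cancel_iff, Nat.choose_self, one_mul, one_mul] at key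
  exact Nat.eq_of_mul_eq_mul_right (hW0 t) key

end Counting

section Consequences

variable {k : ℕ} {π π' : Pattern k}

theorem mem_prefixValues_streak_succ (π : Pattern k) (hk : streak π < k) {p : ℕ} (hp : p < k) :
    p ∈ prefixValues π (streak π + 1) ↔ p < streak π ∨ p = π ⟨streak π, hk⟩ := by
  obtain ⟨j, hj⟩ := π.surjective ⟨p, hp⟩
  obtain rfl : (π j : ℕ) = p := congrArg Fin.val hj
  rw [mem_prefixValues, Nat.lt_succ_iff_lt_or_eq]
  refine or_congr ⟨fun h => ?_, fun h => ?_⟩ ⟨fun h => ?_, fun h => ?_⟩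
  · rwa [apply_of_lt_streak π j h]
  · have h1 := apply_of_lt_streak π (π j) h
    rw [π.injective (Fin.ext h1)] at h
    exact h
  · rw [show j = ⟨streak π, hk⟩ from Fin.ext h]
  · exact congrArg Fin.val (π.injective (Fin.ext h))

theorem apply_streak_eq_or (hπ : Grounded π) (hπ' : Grounded π') (h : StrongCEquiv π π')
    (hs : streak π = streak π') (hk : streak π < k) (hk' : streak π' < k) :
    (π ⟨streak π, hk⟩ : ℕ) = π' ⟨streak π', hk'⟩ ∨
      (π ⟨streak π, hk⟩ : ℕ) + π' ⟨streak π', hk'⟩ + 1 = streak π + k := by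
  have h1 := pathCount_prefixValues_eq hπ hπ' h hs (lt_add_one _) hk
  have ha := streak_lt_apply π hk
  have ha' := streak_lt_apply π' hk'
  have hb := (π ⟨streak π, hk⟩).2
  have hb' := (π' ⟨streak π', hk'⟩).2
  have e := pathCount_two_gaps ha hb fun p hp => mem_prefixValues_streak_succ π hk hp
  have e' := pathCount_two_gaps ha' hb' fun p hp => mem_prefixValues_streak_succ π' hk' hp
  generalize (π ⟨streak π, hk⟩ : ℕ) = a at *
  generalize (π' ⟨streak π', hk'⟩ : ℕ) = b at *
  rw [← hs] at e' ha'
  rw [e, e'] at h1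
  have h2 := eq_or_eq_of_centralBinom_mul_eq (N := k - 1 - streak π)
    (x := k - 1 - a) (y := k - 1 - b) (by omega) (by omega) (by
      rwa [show k - 1 - streak π - (k - 1 - a) = a - streak π by omega,
        show k - 1 - streak π - (k - 1 - b) = b - streak π by omega])
  omega

theorem suffix_no_consecutive_iff (π : Pattern k) {t : ℕ} (ht : t ≤ k) :
    (∀ i j : Fin k, t ≤ (i : ℕ) → t ≤ (j : ℕ) → (π j : ℕ) ≠ (π i : ℕ) + 1) ↔
      pathCount (prefixValues π t) k k = 2 ^ (k - t) := by
  have hcard : #(range k \ prefixValues π t) = k - t := by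
    rw [card_sdiff_of_subset (prefixValues_subset π t), card_prefixValues π ht, card_range]
  rw [← hcard, (two_pow_le_pathCount_diag (prefixValues π t) k).2]
  constructor
  · intro h p hp
    obtain ⟨i, hi⟩ := π.surjective ⟨p, by omega⟩
    obtain ⟨j, hj⟩ := π.surjective ⟨p + 1, hp⟩
    replace hi : (π i : ℕ) = p := congrArg Fin.val hi
    replace hj : (π j : ℕ) = p + 1 := congrArg Fin.val hj
    rw [← hj, ← hi, mem_prefixValues, mem_prefixValues]
    by_contra! hcon
    exact h i j hcon.1 hcon.2 (by omega)
  · intro h i j hi hj hij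
    have := h (π i) (by rw [← hij]; exact (π j).2)
    rw [← hij, mem_prefixValues, mem_prefixValues] at this
    omega

theorem exists_consecutive_of_le_streak (π : Pattern k) (hk : streak π < k) {t : ℕ}
    (ht : t ≤ streak π) :
    ¬ ∀ i j : Fin k, t ≤ (i : ℕ) → t ≤ (j : ℕ) → (π j : ℕ) ≠ (π i : ℕ) + 1 := by
  intro h
  have hlt := streak_lt_apply π hk
  have hb := (π ⟨streak π, hk⟩).2
  have key : ∀ x : Fin k, streak π ≤ π x → t ≤ x := by
    intro x hx
    by_contra! hxt
    rw [apply_of_lt_streak π x (by omega)] at hx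
    omega
  obtain ⟨i, hi⟩ := π.surjective ⟨streak π, hk⟩
  obtain ⟨j, hj⟩ := π.surjective ⟨streak π + 1, by omega⟩
  replace hi : (π i : ℕ) = streak π := congrArg Fin.val hi
  replace hj : (π j : ℕ) = streak π + 1 := congrArg Fin.val hj
  exact h i j (key i (by omega)) (key j (by omega)) (by omega)

theorem dStat_eq (hπ : Grounded π) (hπ' : Grounded π') (h : StrongCEquiv π π')
    (hs : streak π = streak π') (hk : streak π < k) : dStat π = dStat π' := by
  have key : ∀ t : ℕ,
      (∀ i j : Fin k, t ≤ (i : ℕ) → t ≤ (j : ℕ) → (π j : ℕ) ≠ (π i : ℕ) + 1) ↔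
        ∀ i j : Fin k, t ≤ (i : ℕ) → t ≤ (j : ℕ) → (π' j : ℕ) ≠ (π' i : ℕ) + 1 := by
    intro t
    rcases le_or_gt t (streak π) with ht | ht
    · exact iff_of_false (exists_consecutive_of_le_streak π hk ht)
        (exists_consecutive_of_le_streak π' (hs ▸ hk) (hs ▸ ht))
    · rcases le_or_gt t k with htk | htk
      · rw [suffix_no_consecutive_iff π htk, suffix_no_consecutive_iff π' htk,
          pathCount_prefixValues_eq hπ hπ' h hs ht htk]
      · exact iff_of_true (fun i _ hi => by omega) (fun i _ hi => by omega)
  unfold dStat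
  congr 1
  ext d
  simp only [Set.mem_ofPred_eq]
  refine and_congr_right fun hd => ?_
  obtain ⟨t, rfl⟩ : ∃ t, d = t + 1 := ⟨d - 1, by omega⟩
  simpa only [Nat.add_le_add_iff_right] using key t

end Consequences

end RForest

end ForkCounting

/-- For strongly c-forest-Wilf equivalent grounded patterns `π, π'` of streak `s`:
`π(s+1) = π'(s+1)` or `π(s+1) + π'(s+1) = s + k + 1` (stated with 0-indexed positions
and values, so `(π ⟨s⟩ : ℕ) + 1` is the 1-indexed value `π(s+1)`), and `d = d'`. -/
theorem strongCEquiv_grounded_next_entry_and_d {k : ℕ} (π π' : Pattern k) (s : ℕ)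
    (hπ : Grounded π) (hπ' : Grounded π') (h : StrongCEquiv π π')
    (hs : streak π = s) (hs' : streak π' = s) (hsk : s < k) :
    ((π ⟨s, hsk⟩ : ℕ) = (π' ⟨s, hsk⟩ : ℕ) ∨
      ((π ⟨s, hsk⟩ : ℕ) + 1) + ((π' ⟨s, hsk⟩ : ℕ) + 1) = s + k + 1) ∧
    dStat π = dStat π' := by
  subst hs
  refine ⟨?_, RForest.dStat_eq hπ hπ' h hs'.symm hsk⟩
  have := RForest.apply_streak_eq_or hπ hπ' h hs'.symm hsk (hs'.symm ▸ hsk)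
  simp only [hs'] at this
  omega
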